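/- For the Schrödinger operator with linear potential q(x) = x on (a,b) and Dirichlet boundary conditions, if zero is not an eigenvalue (i.e., Ai(a)Bi(b) ≠ Bi(a)Ai(b)), then the sum of reciprocals of the eigenvalues equals π (Bi(a)Ai(b) − Ai(a)Bi(b))^{−1} [Ai(a)Ai(b)(Bi'(a)² − Bi'(b)²) + Bi(a)Bi(b)(Ai'(a)² − Ai'(b)²) + (Ai'(b)Bi'(b) − Ai'(a)Bi'(a))(Bi(a)Ai(b) + Ai(a)Bi(b))]. -/

import Mathlib

open Real

/-- coefficients of the Airy power series -/
noncomputable def airyCoef (s : ℕ) : ℕ → ℂ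
  | 0 => 1
  | k + 1 => airyCoef s k / ((3 * k + 3 + s) * (3 * k + 2 + s))

lemma airyCoef_norm (s k : ℕ) : ‖airyCoef s k‖ ≤ 1 / (k.factorial : ℝ) := by
  induction k with
  | zero => simp [airyCoef]
  | succ k ih =>
    have h : ((3 * k + 3 + s : ℂ) * (3 * k + 2 + s)) = (((3 * k + 3 + s) * (3 * k + 2 + s) : ℕ) : ℂ) := by
      push_cast; ring
    rw [airyCoef, h, norm_div, Complex.norm_natCast, Nat.factorial_succ, Nat.cast_mul (k + 1),
      mul_comm ((k + 1 : ℕ) : ℝ), ← div_div]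
    have h2 : ((k + 1 : ℕ) : ℝ) ≤ (((3 * k + 3 + s) * (3 * k + 2 + s) : ℕ) : ℝ) := by
      norm_cast; nlinarith
    gcongr

lemma airy_entire (s : ℕ) (hs : s = 0 ∨ s = 1) : ∃ F F' : ℂ → ℂ, (∀ z, HasDerivAt F (F' z) z) ∧
    (∀ z, HasDerivAt F' (z * F z) z) ∧ F 0 = (if s = 0 then 1 else 0) ∧
      F' 0 = (if s = 0 then 0 else 1) := by
  set t : ℕ → ℂ → ℂ := fun k z => airyCoef s k * z ^ (3 * k + s) with ht
  set S : ℕ → ℂ → ℂ := fun N z => ∑ k ∈ Finset.range N, t k z with hS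
  set F : ℂ → ℂ := fun z => ∑' k, t k z with hF
  have hdS : ∀ N, Differentiable ℂ (S N) := fun N => by
    simp only [hS, ht]; fun_prop
  have hloc : TendstoLocallyUniformlyOn S F Filter.atTop Set.univ := by
    rw [tendstoLocallyUniformlyOn_iff_forall_isCompact isOpen_univ]
    intro K _ hK
    obtain ⟨R, hR⟩ := hK.isBounded.exists_norm_le
    set R' := max R 0
    have hsum : Summable fun k : ℕ => R' ^ s * ((R' ^ 3) ^ k / (k.factorial : ℝ)) :=
      (Real.summable_pow_div_factorial (R' ^ 3)).mul_left _
    apply tendstoUniformlyOn_tsum_nat hsum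
    intro k z hz
    have h1 : ‖z‖ ≤ R' := (hR z hz).trans (le_max_left _ _)
    calc ‖t k z‖ = ‖airyCoef s k‖ * ‖z‖ ^ (3 * k + s) := by simp [ht]
      _ ≤ 1 / (k.factorial : ℝ) * R' ^ (3 * k + s) := by
        gcongr; exact airyCoef_norm s k
      _ = _ := by rw [pow_add, pow_mul]; ring
  have hS1 : ∀ N z, HasDerivAt (S N) (∑ k ∈ Finset.range N,
      airyCoef s k * ((3 * k + s : ℕ) * z ^ (3 * k + s - 1))) z := fun N z =>
    HasDerivAt.fun_sum fun k _ => (hasDerivAt_pow (3 * k + s) z).const_mul _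
  have hS2 : ∀ N, deriv (deriv (S (N + 1))) = fun z => z * S N z := by
    intro N
    have : deriv (S (N + 1)) = fun z => ∑ k ∈ Finset.range (N + 1),
      airyCoef s k * ((3 * k + s : ℕ) * z ^ (3 * k + s - 1)) := funext fun z => (hS1 _ z).deriv
    rw [this]
    funext z
    have h2 : HasDerivAt (fun z => ∑ k ∈ Finset.range (N + 1),
      airyCoef s k * ((3 * k + s : ℕ) * z ^ (3 * k + s - 1))) (∑ k ∈ Finset.range (N + 1),
      airyCoef s k * ((3 * k + s : ℕ) * ((3 * k + s - 1 : ℕ) * z ^ (3 * k + s - 1 - 1)))) z :=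
      HasDerivAt.fun_sum fun k _ => ((hasDerivAt_pow (3 * k + s - 1) z).const_mul _).const_mul _
    rw [h2.deriv, Finset.sum_range_succ', hS, Finset.mul_sum]
    have h0 : airyCoef s 0 * (((3 * 0 + s : ℕ) : ℂ) * (((3 * 0 + s - 1 : ℕ) : ℂ) * z ^ (3 * 0 + s - 1 - 1))) = 0 := by
      rcases hs with rfl | rfl <;> simp
    rw [h0, add_zero]
    refine Finset.sum_congr rfl fun k _ => ?_
    have e1 : 3 * (k + 1) + s - 1 = 3 * k + 2 + s := by omega
    have e2 : 3 * k + 2 + s - 1 = 3 * k + s + 1 := by omega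
    simp only [ht]
    rw [e1, e2, airyCoef]
    have n1 : (3 * k + 3 + s : ℂ) ≠ 0 := by norm_cast; omega
    have n2 : (3 * k + 2 + s : ℂ) ≠ 0 := by norm_cast; omega
    push_cast
    rw [show (3 * ((k : ℂ) + 1) + s) = 3 * k + 3 + s by ring]
    generalize (3 * k + 3 + s : ℂ) = u at *
    generalize (3 * k + 2 + s : ℂ) = v at *
    field_simp
    ring
  have hl1 := hloc.deriv (Filter.Eventually.of_forall fun N => (hdS N).differentiableOn) isOpen_univ
  have hdS' : ∀ N, Differentiable ℂ (deriv (S N)) := fun N =>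
    ((hdS N).contDiff (n := 2)).differentiable_deriv_two
  have hl2 := hl1.deriv (Filter.Eventually.of_forall fun N => (hdS' N).differentiableOn) isOpen_univ
  have hFd : Differentiable ℂ F := differentiableOn_univ.1 <| hloc.differentiableOn
    (Filter.Eventually.of_forall fun N => (hdS N).differentiableOn) isOpen_univ
  have hFd' : Differentiable ℂ (deriv F) := (hFd.contDiff (n := 2)).differentiable_deriv_two
  have hF2 : ∀ z, deriv (deriv F) z = z * F z := by
    intro z
    have a1 := (Filter.tendsto_add_atTop_iff_nat 1).2 (hl2.tendsto_at (Set.mem_univ z))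
    have a2 := (hloc.tendsto_at (Set.mem_univ z)).const_mul z
    refine tendsto_nhds_unique a1 (a2.congr fun N => ?_)
    simp [hS2]
  refine ⟨F, deriv F, fun z => (hFd z).hasDerivAt, fun z => ?_, ?_, ?_⟩
  · rw [← hF2]; exact (hFd' z).hasDerivAt
  · refine tendsto_nhds_unique ((Filter.tendsto_add_atTop_iff_nat 1).2 (hloc.tendsto_at (Set.mem_univ 0))) (tendsto_const_nhds.congr fun N => ?_)
    simp only [hS, ht]
    rw [Finset.sum_range_succ', Finset.sum_eq_zero]
    · rcases hs with rfl | rfl <;> simp [airyCoef]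
    · intro k _
      simp
  · refine tendsto_nhds_unique ((Filter.tendsto_add_atTop_iff_nat 1).2 (hl1.tendsto_at (Set.mem_univ 0))) (tendsto_const_nhds.congr fun N => ?_)
    simp only [Function.comp]
    rw [(hS1 _ 0).deriv, Finset.sum_range_succ', Finset.sum_eq_zero]
    · rcases hs with rfl | rfl <;> simp [airyCoef]
    · intro k _
      rw [show 3 * (k + 1) + s - 1 = (3 * k + s + 1) + 1 by omega]
      simp

/-- real solutions of the Airy equation extend to entire ones -/
lemma airy_extend (y : ℝ → ℝ) (hy : ContDiff ℝ 2 y)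
    (hode : ∀ x : ℝ, deriv (deriv y) x = x * y x) :
    ∃ A A' : ℂ → ℂ, (∀ z, HasDerivAt A (A' z) z) ∧ (∀ z, HasDerivAt A' (z * A z) z) ∧
      (∀ x : ℝ, A x = y x) ∧ (∀ x : ℝ, A' x = deriv y x) := by
  obtain ⟨F, F', hF, hF', F0, F0'⟩ := airy_entire 0 (Or.inl rfl)
  obtain ⟨G, G', hG, hG', G0, G0'⟩ := airy_entire 1 (Or.inr rfl)
  simp only [if_true, one_ne_zero, if_false] at F0 F0' G0 G0'
  have d1 : ∀ x : ℝ, HasDerivAt (fun x : ℝ => (y x : ℂ)) (deriv y x : ℝ) x := fun x =>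
    ((hy.differentiable (by norm_num)) x).hasDerivAt.ofReal_comp
  have d2 : ∀ x : ℝ, HasDerivAt (fun x : ℝ => ((deriv y x : ℝ) : ℂ)) ((x : ℂ) * y x) x := fun x => by
    have := ((hy.differentiable_deriv_two) x).hasDerivAt.ofReal_comp
    rw [hode] at this
    simpa using this
  have hWc : ∀ z, F z * G' z - F' z * G z = 1 := by
    have hd : ∀ z, HasDerivAt (fun z => F z * G' z - F' z * G z) 0 z := fun z => by
      refine HasDerivAt.congr_deriv (((hF z).mul (hG' z)).sub ((hF' z).mul (hG z))) ?_
      ring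
    intro z
    have := is_const_of_deriv_eq_zero (fun z => (hd z).differentiableAt) (fun z => (hd z).deriv) z 0
    simpa [F0, F0', G0, G0'] using this
  have hc : ∀ H H' : ℂ → ℂ, (∀ z, HasDerivAt H (H' z) z) → (∀ z, HasDerivAt H' (z * H z) z) →
      ∃ c : ℂ, ∀ x : ℝ, (y x : ℂ) * H' x - (deriv y x : ℝ) * H x = c := by
    intro H H' hH hH'
    have hd : ∀ x : ℝ, HasDerivAt (fun x : ℝ => (y x : ℂ) * H' x - (deriv y x : ℝ) * H x) 0 x := fun x => by
      refine HasDerivAt.congr_deriv (((d1 x).mul (hH' x).comp_ofReal).sub ((d2 x).mul (hH x).comp_ofReal)) ?_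
      ring
    exact ⟨_, fun x => is_const_of_deriv_eq_zero (fun z => (hd z).differentiableAt) (fun z => (hd z).deriv) x 0⟩
  obtain ⟨c, hc1⟩ := hc G G' hG hG'
  obtain ⟨e, he1⟩ := hc F F' hF hF'
  refine ⟨fun z => c * F z - e * G z, fun z => c * F' z - e * G' z, fun z => ((hF z).const_mul c).sub ((hG z).const_mul e),
    fun z => ?_, fun x => ?_, fun x => ?_⟩
  · refine HasDerivAt.congr_deriv (((hF' z).const_mul c).sub ((hG' z).const_mul e)) ?_
    ring
  · simp only [← hc1 x, ← he1 x]
    linear_combination (y x : ℂ) * hWc x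
  · simp only [← hc1 x, ← he1 x]
    linear_combination ((deriv y x : ℝ) : ℂ) * hWc x

lemma logDeriv_bound (G : ℂ → ℂ) (hG : Differentiable ℂ G) (R M A : ℝ) (hR : 0 < R) (hA : 0 < A)
    (hne : ∀ z ∈ Metric.ball (0 : ℂ) R, G z ≠ 0) (hM : ∀ z ∈ Metric.ball (0 : ℂ) R, ‖G z‖ ≤ M)
    (hMA : Real.log M - Real.log ‖G 0‖ ≤ A) : ‖logDeriv G 0‖ ≤ 4 * A / R := by
  have h0 : (0 : ℂ) ∈ Metric.ball (0 : ℂ) R := Metric.mem_ball_self hR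
  have hG' : Differentiable ℂ (deriv G) := (hG.contDiff (n := 2)).differentiable_deriv_two
  have hd : DifferentiableOn ℂ (fun z => deriv G z / G z) (Metric.ball 0 R) :=
    hG'.differentiableOn.div hG.differentiableOn hne
  obtain ⟨h, hh⟩ := hd.isExactOn_ball
  have hconst : ∀ z ∈ Metric.ball (0 : ℂ) R, G z * Complex.exp (-h z) = G 0 * Complex.exp (-h 0) := by
    have hder : ∀ z ∈ Metric.ball (0 : ℂ) R,
        HasDerivAt (fun z => G z * Complex.exp (-h z)) 0 z := by
      intro z hz
      refine ((hG z).hasDerivAt.mul (hh z hz).neg.cexp).congr_deriv ?_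
      have := hne z hz
      field_simp
      ring
    intro z hz
    exact Metric.isOpen_ball.is_const_of_deriv_eq_zero (convex_ball (0 : ℂ) R).isPreconnected
      (fun z hz => (hder z hz).differentiableAt.differentiableWithinAt)
      (fun z hz => (hder z hz).deriv) hz h0
  set k : ℂ → ℂ := fun z => h z - h 0 with hk
  have hkG : ∀ z ∈ Metric.ball (0 : ℂ) R, G z = G 0 * Complex.exp (k z) := by
    intro z hz
    have h1 := hconst z hz
    have : G z = (G z * Complex.exp (-h z)) * Complex.exp (h z) := by
      rw [mul_assoc, ← Complex.exp_add]; simp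
    rw [this, h1, mul_assoc, ← Complex.exp_add]
    congr 2
    simp only [hk]; ring
  have hkd : ∀ z ∈ Metric.ball (0 : ℂ) R, HasDerivAt k (deriv G z / G z) z := fun z hz =>
    (hh z hz).sub_const _
  have hkD : DifferentiableOn ℂ k (Metric.ball 0 R) := fun z hz =>
    (hkd z hz).differentiableAt.differentiableWithinAt
  have hmaps : Set.MapsTo k (Metric.ball 0 R) {z | z.re ≤ A} := by
    intro z hz
    have h1 := hM z hz
    have hg0 : 0 < ‖G 0‖ := norm_pos_iff.2 (hne 0 h0)
    have h2 : Real.log ‖G z‖ = Real.log ‖G 0‖ + (k z).re := by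
      rw [hkG z hz, norm_mul, Complex.norm_exp, Real.log_mul hg0.ne' (Real.exp_pos _).ne',
        Real.log_exp]
    have h3 := Real.log_le_log (norm_pos_iff.2 (hne z hz)) h1
    show (k z).re ≤ A
    linarith
  have hbound : ∀ z ∈ Metric.sphere (0 : ℂ) (R / 2), ‖k z‖ ≤ 2 * A := by
    intro z hz
    have hz' : ‖z‖ = R / 2 := by simpa using hz
    have := Complex.borelCaratheodory_zero hA hkD hmaps hR (z := z) (by simp [hz']; linarith) (by simp [hk])
    rw [hz'] at this
    refine this.trans (le_of_eq ?_)
    field_simp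
    ring
  have hfin := Complex.norm_deriv_le_of_forall_mem_sphere_norm_le (c := (0 : ℂ)) (R := R / 2) (f := k) (by positivity)
    ((hkD.mono (Metric.closedBall_subset_ball (by linarith))).diffContOnCl_ball subset_rfl) hbound
  rw [(hkd 0 h0).deriv] at hfin
  rw [logDeriv_apply]
  refine hfin.trans (le_of_eq ?_)
  field_simp
  ring

lemma factor_out (f : ℂ → ℂ) (hf : Differentiable ℂ f) (S : Finset ℝ) (hS : ∀ x ∈ S, f (x : ℂ) = 0) :
    ∃ g : ℂ → ℂ, Differentiable ℂ g ∧ ∀ z, f z = (∏ x ∈ S, (z - (x : ℂ))) * g z := by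
  induction S using Finset.cons_induction with
  | empty => exact ⟨f, hf, by simp⟩
  | cons a s ha ih =>
    obtain ⟨g, hg, hfg⟩ := ih fun x hx => hS x (by simp [hx])
    have hga : g (a : ℂ) = 0 := by
      have h1 := hfg a
      rw [hS a (by simp)] at h1
      rcases mul_eq_zero.1 h1.symm with h | h
      · rw [Finset.prod_eq_zero_iff] at h
        obtain ⟨x, hx, hxa⟩ := h
        have : a = x := by exact_mod_cast sub_eq_zero.1 hxa
        exact absurd (this ▸ hx) ha
      · exact h
    refine ⟨dslope g a, ?_, fun z => ?_⟩
    · rw [← differentiableOn_univ]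
      exact (Complex.differentiableOn_dslope Filter.univ_mem).2 hg.differentiableOn
    · have := sub_smul_dslope g (a : ℂ) z
      rw [hga, sub_zero, smul_eq_mul] at this
      rw [Finset.prod_cons, hfg z, ← this]
      ring

lemma finite_step (f : ℂ → ℂ) (hf : Differentiable ℂ f) (S : Finset ℝ) (R M A : ℝ) (hR : 0 < R)
    (hA : 0 < A) (hS : ∀ x ∈ S, f (x : ℂ) = 0) (hSR : ∀ x ∈ S, |x| < R)
    (hall : ∀ z : ℂ, ‖z‖ < R → f z = 0 → ∃ x ∈ S, z = (x : ℂ))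
    (hsimple : ∀ x ∈ S, deriv f (x : ℂ) ≠ 0) (h0 : f 0 ≠ 0)
    (hM : ∀ z : ℂ, ‖z‖ = R → ‖f z‖ ≤ M) (hMA : Real.log M - Real.log ‖f 0‖ ≤ A) :
    ‖deriv f 0 / f 0 + ∑ x ∈ S, ((x : ℂ)⁻¹ - x / R ^ 2)‖ ≤ 4 * A / R ∧
      ((S.filter fun x => |x| < R / 2).card : ℝ) * Real.log 2 ≤ A := by
  obtain ⟨g, hg, hfg⟩ := factor_out f hf S hS
  have hx0 : ∀ x ∈ S, (x : ℂ) ≠ 0 := by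
    intro x hx h
    have := hS x hx
    rw [h] at this
    exact h0 this
  have hRC : (R : ℂ) ≠ 0 := by exact_mod_cast hR.ne'
  have hg0 : g 0 ≠ 0 := by
    intro h
    apply h0
    rw [hfg, h, mul_zero]
  have hgne : ∀ z ∈ Metric.ball (0 : ℂ) R, g z ≠ 0 := by
    intro z hz hgz
    have hfz : f z = 0 := by rw [hfg, hgz, mul_zero]
    obtain ⟨x, hx, rfl⟩ := hall z (by simpa using hz) hfz
    apply hsimple x hx
    have hfun : f = fun z => (∏ x ∈ S, (z - (x : ℂ))) * g z := funext hfg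
    have hP : DifferentiableAt ℂ (fun z => ∏ x ∈ S, (z - (x : ℂ))) (x : ℂ) := by fun_prop
    have hd := (hP.hasDerivAt.mul (hg x).hasDerivAt).deriv
    have hz0 : ∏ y ∈ S, ((x : ℂ) - (y : ℂ)) = 0 := Finset.prod_eq_zero hx (sub_self _)
    rw [hgz, hz0] at hd
    rw [hfun]
    refine Eq.trans hd ?_
    simp
  set G : ℂ → ℂ := fun z => (∏ x ∈ S, ((R ^ 2 - x * z) / R : ℂ)) * g z with hG
  have hGd : Differentiable ℂ G := by
    simp only [hG]; fun_prop
  have hbne : ∀ z ∈ Metric.ball (0 : ℂ) R, ∀ x ∈ S, ((R ^ 2 - x * z) / R : ℂ) ≠ 0 := by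
    intro z hz x hx h
    rw [div_eq_zero_iff] at h
    rcases h with h | h
    · have h1 : ‖(R ^ 2 : ℂ)‖ = ‖(x * z : ℂ)‖ := by rw [sub_eq_zero.1 h]
      rw [norm_pow, norm_mul, Complex.norm_real, Complex.norm_real, Real.norm_eq_abs,
        Real.norm_eq_abs, abs_of_pos hR] at h1
      have h2 := hSR x hx
      have h3 : ‖z‖ < R := by simpa using hz
      nlinarith [abs_nonneg x, norm_nonneg z]
    · exact hRC h
  have hGne : ∀ z ∈ Metric.ball (0 : ℂ) R, G z ≠ 0 := fun z hz =>
    mul_ne_zero (Finset.prod_ne_zero_iff.2 (hbne z hz)) (hgne z hz)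
  have hGs : ∀ z : ℂ, ‖z‖ = R → ‖G z‖ ≤ M := by
    intro z hz
    refine le_trans (le_of_eq ?_) (hM z hz)
    rw [hfg, hG, norm_mul, norm_mul, norm_prod, norm_prod]
    congr 1
    refine Finset.prod_congr rfl fun x hx => ?_
    have h1 : (R ^ 2 : ℂ) = z * (starRingEnd ℂ) z := by
      rw [Complex.mul_conj, Complex.normSq_eq_norm_sq, hz]; push_cast; rfl
    have h2 : (R ^ 2 - x * z : ℂ) = z * (starRingEnd ℂ) (z - x) := by
      rw [h1, map_sub, Complex.conj_ofReal]; ring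
    rw [h2, norm_div, norm_mul, hz, Complex.norm_real, Real.norm_eq_abs, abs_of_pos hR,
      Complex.norm_conj]
    field_simp
  have hGM : ∀ z ∈ Metric.closedBall (0 : ℂ) R, ‖G z‖ ≤ M := by
    intro z hz
    refine Complex.norm_le_of_forall_mem_frontier_norm_le Metric.isBounded_ball
      (hGd.diffContOnCl (s := Metric.ball (0 : ℂ) R)) (fun w hw => ?_) (z := z) ?_
    · rw [frontier_ball _ hR.ne'] at hw
      exact hGs w (by simpa using hw)
    · rwa [closure_ball _ hR.ne']
  have hzb : (0 : ℂ) ∈ Metric.ball (0 : ℂ) R := Metric.mem_ball_self hR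
  have hG0 : ‖G 0‖ = ‖f 0‖ * ∏ x ∈ S, (R / |x|) := by
    rw [hfg, hG, norm_mul, norm_mul, norm_prod, norm_prod, mul_right_comm, ← Finset.prod_mul_distrib]
    congr 1
    refine Finset.prod_congr rfl fun x hx => ?_
    have : |x| ≠ 0 := by
      have := hx0 x hx
      simpa using this
    simp only [mul_zero, sub_zero, zero_sub, norm_neg, norm_div, norm_pow, Complex.norm_real, Real.norm_eq_abs, abs_of_pos hR]
    field_simp
  have hfpos : 0 < ‖f 0‖ := norm_pos_iff.2 h0
  have hge : ∀ x ∈ S, 1 ≤ R / |x| := by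
    intro x hx
    have : 0 < |x| := by
      have := hx0 x hx
      simpa using this
    rw [le_div_iff₀ this]; linarith [hSR x hx]
  have hprod1 : 1 ≤ ∏ x ∈ S, (R / |x|) := by
    calc (1 : ℝ) = ∏ x ∈ S, (1 : ℝ) := by simp
      _ ≤ _ := Finset.prod_le_prod (fun _ _ => zero_le_one) hge
  have hG0ge : ‖f 0‖ ≤ ‖G 0‖ := by rw [hG0]; nlinarith
  constructor
  · have hb := logDeriv_bound G hGd R M A hR hA hGne
      (fun z hz => hGM z (Metric.ball_subset_closedBall hz))
      (by have := Real.log_le_log hfpos hG0ge; linarith)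
    have hlf : logDeriv f 0 = (∑ x ∈ S, -(x : ℂ)⁻¹) + logDeriv g 0 := by
      have hfun : f = fun z => (∏ x ∈ S, (z - (x : ℂ))) * g z := funext hfg
      rw [hfun, logDeriv_mul _ _ hg0 (by fun_prop) (hg 0), logDeriv_prod]
      · congr 1
        refine Finset.sum_congr rfl fun x hx => ?_
        rw [logDeriv_apply]
        simp
      · intro x hx; simpa using hx0 x hx
      · intro x hx; fun_prop
      · rw [Finset.prod_ne_zero_iff]
        intro x hx; simpa using hx0 x hx
    have hlG : logDeriv G 0 = (∑ x ∈ S, -(x / R ^ 2 : ℂ)) + logDeriv g 0 := by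
      rw [hG, logDeriv_mul _ _ hg0 (by fun_prop) (hg 0), logDeriv_prod]
      · congr 1
        refine Finset.sum_congr rfl fun x hx => ?_
        rw [logDeriv_apply]
        have : HasDerivAt (fun z : ℂ => ((R ^ 2 - x * z) / R : ℂ)) (-(x * 1) / R) 0 :=
          (((hasDerivAt_id (0 : ℂ)).const_mul (x : ℂ)).const_sub _).div_const _
        rw [this.deriv]
        simp only [mul_zero, sub_zero]
        field_simp
      · exact hbne 0 hzb
      · intro x hx; fun_prop
      · exact Finset.prod_ne_zero_iff.2 (hbne 0 hzb)
    rw [← logDeriv_apply]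
    have : logDeriv f 0 + ∑ x ∈ S, ((x : ℂ)⁻¹ - x / R ^ 2) = logDeriv G 0 := by
      rw [hlf, hlG, Finset.sum_sub_distrib, Finset.sum_neg_distrib, Finset.sum_neg_distrib]
      ring
    rw [this]; exact hb
  · have h1 : (2 : ℝ) ^ (S.filter fun x => |x| < R / 2).card ≤ ∏ x ∈ S, (R / |x|) := by
      calc (2 : ℝ) ^ (S.filter fun x => |x| < R / 2).card
          = ∏ x ∈ S.filter fun x => |x| < R / 2, (2 : ℝ) := by simp
        _ = ∏ x ∈ S, (if |x| < R / 2 then (2 : ℝ) else 1) := by rw [Finset.prod_filter]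
        _ ≤ _ := by
          refine Finset.prod_le_prod (fun x _ => by split_ifs <;> norm_num) fun x hx => ?_
          split_ifs with h
          · have : 0 < |x| := by
              have := hx0 x hx
              simpa using this
            rw [le_div_iff₀ this]; linarith
          · exact hge x hx
    have h2 : ‖f 0‖ * (2 : ℝ) ^ (S.filter fun x => |x| < R / 2).card ≤ M := by
      refine le_trans ?_ (hGM 0 (by simpa using hR.le))
      rw [hG0]; gcongr
    have h3 := Real.log_le_log (by positivity) h2
    rw [Real.log_mul hfpos.ne' (by positivity), Real.log_pow] at h3
    linarith

lemma zeros_finite (f : ℂ → ℂ) (hf : Differentiable ℂ f) (h0 : f 0 ≠ 0) (R : ℝ) :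
    {z : ℂ | ‖z‖ ≤ R ∧ f z = 0}.Finite := by
  have han : AnalyticOnNhd ℂ f Set.univ := fun z _ => hf.analyticAt z
  have hco : (f ⁻¹' {0})ᶜ ∈ Filter.codiscrete ℂ :=
    han.preimage_zero_mem_codiscrete (x := 0) h0
  have hc := mem_codiscrete'.1 hco
  have h1 : IsClosed (f ⁻¹' {0}) := by simpa using hc.1
  have h2 : IsDiscrete (f ⁻¹' {0}) := by simpa using hc.2
  have h3 : (Metric.closedBall (0 : ℂ) R ∩ f ⁻¹' {0}).Finite :=
    ((isCompact_closedBall (0 : ℂ) R).inter_right h1).finite (h2.mono Set.inter_subset_right)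
  refine h3.subset fun z hz => ⟨by simpa using hz.1, hz.2⟩

lemma recip_sum (f : ℂ → ℂ) (hf : Differentiable ℂ f) (C : ℝ) (hC : 0 < C)
    (hgrow : ∀ z : ℂ, 1 ≤ ‖z‖ → ‖f z‖ ≤ Real.exp (C * √‖z‖))
    (P : ℝ → Prop) (hP : ∀ x : ℝ, P x ↔ f (x : ℂ) = 0)
    (hreal : ∀ z : ℂ, f z = 0 → ∃ x : ℝ, z = x)
    (hsimple : ∀ x : ℝ, f (x : ℂ) = 0 → deriv f (x : ℂ) ≠ 0)
    (m : ℝ) (hlow : ∀ x : ℝ, f (x : ℂ) = 0 → m ≤ x) (h0 : f 0 ≠ 0)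
    (T : ℝ) (hT : deriv f 0 / f 0 = ((-T : ℝ) : ℂ)) :
    HasSum (fun i : {x : ℝ // P x} => (i : ℝ)⁻¹) T := by
  have hfin : ∀ R : ℝ, {i : {x : ℝ // P x} | |(i : ℝ)| < R}.Finite := by
    intro R
    refine Set.Finite.of_finite_image (f := fun i : {x : ℝ // P x} => ((i : ℝ) : ℂ)) ?_ ?_
    · refine (zeros_finite f hf h0 R).subset ?_
      rintro _ ⟨i, hi, rfl⟩
      exact ⟨by simpa using le_of_lt hi, (hP i).1 i.2⟩
    · intro i _ j _ hij
      exact Subtype.ext (Complex.ofReal_injective hij)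
  set s : ℕ → Finset {x : ℝ // P x} := fun n => (hfin (n + 1)).toFinset with hs
  have hmem : ∀ n i, i ∈ s n ↔ |(i : ℝ)| < n + 1 := by intro n i; simp [hs]
  set D : ℝ := C + |Real.log ‖f 0‖| with hD
  have hDpos : 0 < D := by positivity
  -- application of the finite step
  have hstep : ∀ n : ℕ, |∑ i ∈ s n, ((i : ℝ)⁻¹ - i / (n + 1) ^ 2) - T| ≤ 4 * (D * √(n + 1)) / (n + 1) ∧
      ((((s n).map (Function.Embedding.subtype P)).filter fun x => |x| < ((n : ℝ) + 1) / 2).card : ℝ) * Real.log 2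
        ≤ D * √(n + 1) := by
    intro n
    have hR : (0 : ℝ) < n + 1 := by positivity
    have hsq : 1 ≤ √((n : ℝ) + 1) := Real.one_le_sqrt.2 (by linarith [(Nat.cast_nonneg n : (0 : ℝ) ≤ n)])
    have key := finite_step f hf ((s n).map (Function.Embedding.subtype P)) (n + 1)
      (Real.exp (C * √(n + 1))) (D * √(n + 1)) hR (by positivity)
      (by
        intro x hx
        simp only [Finset.mem_map, Function.Embedding.subtype_apply] at hx
        obtain ⟨i, _, rfl⟩ := hx
        exact (hP _).1 i.2)
      (by
        intro x hx
        simp only [Finset.mem_map, Function.Embedding.subtype_apply] at hx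
        obtain ⟨i, hi, rfl⟩ := hx
        exact (hmem n i).1 hi)
      (by
        intro z hz hfz
        obtain ⟨x, rfl⟩ := hreal z hfz
        refine ⟨x, ?_, rfl⟩
        simp only [Finset.mem_map, Function.Embedding.subtype_apply]
        refine ⟨⟨x, (hP x).2 hfz⟩, (hmem _ _).2 ?_, rfl⟩
        simpa using hz)
      (by
        intro x hx
        simp only [Finset.mem_map, Function.Embedding.subtype_apply] at hx
        obtain ⟨i, _, rfl⟩ := hx
        exact hsimple _ ((hP _).1 i.2))
      h0
      (by
        intro z hz
        have := hgrow z (by rw [hz]; linarith [(Nat.cast_nonneg n : (0 : ℝ) ≤ n)])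
        rwa [hz] at this)
      (by
        rw [Real.log_exp, hD]
        have := neg_abs_le (Real.log ‖f 0‖)
        nlinarith [abs_nonneg (Real.log ‖f 0‖)])
    refine ⟨?_, key.2⟩
    have k1 := key.1
    rw [hT, Finset.sum_map] at k1
    have : ((-T : ℝ) : ℂ) + ∑ i ∈ s n, (((Function.Embedding.subtype P i : ℝ) : ℂ)⁻¹ -
        ((Function.Embedding.subtype P i : ℝ) : ℂ) / (((n : ℝ) + 1 : ℝ) : ℂ) ^ 2) =
        ((∑ i ∈ s n, ((i : ℝ)⁻¹ - i / (n + 1) ^ 2) - T : ℝ) : ℂ) := by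
      push_cast
      simp only [Function.Embedding.subtype_apply]
      ring
    rw [this, Complex.norm_real, Real.norm_eq_abs] at k1
    exact k1
  have hcard : ∀ n : ℕ, ((s n).card : ℝ) * Real.log 2 ≤ D * √(2 * (n + 1)) := by
    intro n
    have h1 := (hstep (2 * n + 1)).2
    have e : ((2 * n + 1 : ℕ) : ℝ) + 1 = 2 * (n + 1) := by push_cast; ring
    rw [e] at h1
    refine le_trans ?_ h1
    have hl : 0 < Real.log 2 := Real.log_pos (by norm_num)
    gcongr
    rw [← Finset.card_map (Function.Embedding.subtype P)]
    refine Finset.card_le_card fun x hx => ?_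
    simp only [Finset.mem_map, Function.Embedding.subtype_apply, Finset.mem_filter] at hx ⊢
    obtain ⟨i, hi, rfl⟩ := hx
    have hi' := (hmem n i).1 hi
    refine ⟨⟨i, (hmem _ i).2 ?_, rfl⟩, ?_⟩
    · rw [e]; linarith [(Nat.cast_nonneg n : (0 : ℝ) ≤ n)]
    · linarith
  have hpart : ∀ n : ℕ, |∑ i ∈ s n, (i : ℝ)⁻¹ - T| ≤ (4 * D + D * √2 / Real.log 2) / √(n + 1) := by
    intro n
    have hR : (0 : ℝ) < n + 1 := by positivity
    have hl : 0 < Real.log 2 := Real.log_pos (by norm_num)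
    have h1 := (hstep n).1
    have h2 : |∑ i ∈ s n, (i : ℝ) / (n + 1) ^ 2| ≤ ((s n).card : ℝ) / ((n : ℝ) + 1) := by
      calc |∑ i ∈ s n, (i : ℝ) / (n + 1) ^ 2| ≤ ∑ i ∈ s n, |(i : ℝ) / (n + 1) ^ 2| :=
            Finset.abs_sum_le_sum_abs _ _
        _ ≤ ∑ i ∈ s n, (1 / ((n : ℝ) + 1)) := by
          refine Finset.sum_le_sum fun i hi => ?_
          have := (hmem n i).1 hi
          rw [abs_div, abs_of_pos (by positivity : (0 : ℝ) < (n + 1) ^ 2), div_le_div_iff₀ (by positivity) hR]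
          nlinarith
        _ = _ := by rw [Finset.sum_const, nsmul_eq_mul]; ring
    have h3 : ((s n).card : ℝ) ≤ D * √2 / Real.log 2 * √(n + 1) := by
      have := hcard n
      rw [Real.sqrt_mul (by norm_num)] at this
      rw [div_mul_eq_mul_div, le_div_iff₀ hl]
      linarith
    have hsq : √((n : ℝ) + 1) * √((n : ℝ) + 1) = n + 1 := Real.mul_self_sqrt hR.le
    have hsp : 0 < √((n : ℝ) + 1) := Real.sqrt_pos.2 hR
    have h4 : ((s n).card : ℝ) / (n + 1) ≤ D * √2 / Real.log 2 / √(n + 1) := by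
      rw [div_le_div_iff₀ hR hsp]
      calc ((s n).card : ℝ) * √(n + 1) ≤ D * √2 / Real.log 2 * √(n + 1) * √(n + 1) := by gcongr
        _ = _ := by rw [mul_assoc, hsq]
    have h5 : 4 * (D * √((n : ℝ) + 1)) / (n + 1) = 4 * D / √(n + 1) := by
      rw [div_eq_div_iff hR.ne' hsp.ne']
      linear_combination 4 * D * hsq
    rw [Finset.sum_sub_distrib] at h1
    rw [add_div]
    rw [h5] at h1
    have h6 := abs_add_le (∑ i ∈ s n, (i : ℝ)⁻¹ - ∑ i ∈ s n, (i : ℝ) / (n + 1) ^ 2 - T) (∑ i ∈ s n, (i : ℝ) / (n + 1) ^ 2)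
    have h7 : ∑ i ∈ s n, (i : ℝ)⁻¹ - ∑ i ∈ s n, (i : ℝ) / (n + 1) ^ 2 - T + ∑ i ∈ s n, (i : ℝ) / (n + 1) ^ 2 = ∑ i ∈ s n, (i : ℝ)⁻¹ - T := by ring
    rw [h7] at h6
    linarith
  have hlim : Filter.Tendsto (fun n : ℕ => ∑ i ∈ s n, (i : ℝ)⁻¹) Filter.atTop (nhds T) := by
    rw [tendsto_iff_dist_tendsto_zero]
    refine squeeze_zero (fun _ => dist_nonneg) (g := fun n : ℕ => (4 * D + D * √2 / Real.log 2) / √((n : ℝ) + 1)) (fun n => by rw [Real.dist_eq]; exact hpart n) ?_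
    refine Filter.Tendsto.div_atTop tendsto_const_nhds ?_
    exact Real.tendsto_sqrt_atTop.comp
      (Filter.tendsto_atTop_add_const_right _ _ tendsto_natCast_atTop_atTop)
  have hmono : Monotone s := by
    intro n k hnk i hi
    rw [hmem] at hi ⊢
    have : (n : ℝ) ≤ k := by exact_mod_cast hnk
    linarith
  have hex : ∀ i, ∃ n, i ∈ s n := by
    intro i
    obtain ⟨n, hn⟩ := exists_nat_gt |(i : ℝ)|
    exact ⟨n, (hmem _ _).2 (by linarith)⟩
  have htop : Filter.Tendsto s Filter.atTop Filter.atTop :=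
    Filter.tendsto_atTop_finset_of_monotone hmono hex
  obtain ⟨n0, hn0⟩ := exists_nat_gt |m|
  have hsummable : Summable (fun i : {x : ℝ // P x} => (i : ℝ)⁻¹) := by
    obtain ⟨B, hB⟩ := hlim.bddAbove_range
    refine Summable.of_abs (summable_of_sum_le (c := B + 2 * ∑ i ∈ s n0, |(i : ℝ)⁻¹|) (fun _ => abs_nonneg _) fun u => ?_)
    obtain ⟨n, hn⟩ : ∃ n, u ⊆ s n := ((htop.eventually_ge_atTop u).exists)
    have hn' : u ⊆ s (max n n0) := hn.trans (hmono (le_max_left _ _))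
    have hsub : s n0 ⊆ s (max n n0) := hmono (le_max_right _ _)
    have hB' : ∑ i ∈ s (max n n0), (i : ℝ)⁻¹ ≤ B := hB ⟨_, rfl⟩
    calc ∑ i ∈ u, |(i : ℝ)⁻¹| ≤ ∑ i ∈ s (max n n0), |(i : ℝ)⁻¹| :=
          Finset.sum_le_sum_of_subset_of_nonneg hn' fun _ _ _ => abs_nonneg _
      _ ≤ ∑ i ∈ s (max n n0), ((i : ℝ)⁻¹ + if i ∈ s n0 then 2 * |(i : ℝ)⁻¹| else 0) := by
          refine Finset.sum_le_sum fun i _ => ?_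
          split_ifs with h
          · have := neg_abs_le (i : ℝ)⁻¹; linarith
          · rw [add_zero]
            have h1 : (n0 : ℝ) + 1 ≤ |(i : ℝ)| := by
              rw [hmem] at h; linarith
            have h2 := hlow i ((hP i).1 i.2)
            have h3 : 0 ≤ (i : ℝ) := by
              by_contra hneg
              push Not at hneg
              rw [abs_of_neg hneg] at h1
              have := neg_abs_le m
              linarith
            rw [abs_of_nonneg (inv_nonneg.2 h3)]
      _ ≤ _ := by
          rw [Finset.sum_add_distrib, ← Finset.sum_filter, Finset.filter_mem_eq_inter,
            Finset.inter_eq_right.2 hsub, ← Finset.mul_sum]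
          linarith
  have h1 := hsummable.hasSum
  have h2 : Filter.Tendsto (fun n : ℕ => ∑ i ∈ s n, (i : ℝ)⁻¹) Filter.atTop (nhds (∑' i : {x : ℝ // P x}, (i : ℝ)⁻¹)) :=
    h1.comp htop
  rw [tendsto_nhds_unique hlim h2]
  exact h1

lemma eq_zero_of_mono (a b : ℝ) (hab : a < b) (h h' : ℝ → ℝ) (hd : ∀ x, HasDerivAt h (h' x) x)
    (hpos : ∀ x ∈ Set.Icc a b, 0 ≤ h' x) (hend : h b = h a) : ∀ x ∈ Set.Icc a b, h' x = 0 := by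
  have hmono : MonotoneOn h (Set.Icc a b) := by
    refine monotoneOn_of_deriv_nonneg (convex_Icc a b) (fun x _ => (hd x).continuousAt.continuousWithinAt)
      (fun x _ => (hd x).differentiableAt.differentiableWithinAt) fun x hx => ?_
    rw [(hd x).deriv]
    exact hpos x (interior_subset hx)
  have hconst : ∀ x ∈ Set.Icc a b, h x = h a := fun x hx =>
    le_antisymm ((hmono hx (Set.right_mem_Icc.2 hab.le) hx.2).trans hend.le)
      (hmono (Set.left_mem_Icc.2 hab.le) hx hx.1)
  intro x hx
  have h1 : HasDerivWithinAt h (h' x) (Set.Icc a b) x := (hd x).hasDerivWithinAt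
  have h2 : HasDerivWithinAt h 0 (Set.Icc a b) x :=
    (hasDerivWithinAt_const x (Set.Icc a b) (h a)).congr hconst (hconst x hx)
  exact (uniqueDiffOn_Icc hab x hx).eq_deriv _ h1 h2

lemma deriv_zero_of_zero {E : Type*} [NormedAddCommGroup E] [NormedSpace ℝ E]
    (a b : ℝ) (hab : a < b) (u v : ℝ → E) (hd : ∀ x, HasDerivAt u (v x) x)
    (h0 : ∀ x ∈ Set.Icc a b, u x = 0) : v a = 0 := by
  have ha : a ∈ Set.Icc a b := Set.left_mem_Icc.2 hab.le
  have h1 : HasDerivWithinAt u (v a) (Set.Icc a b) a := (hd a).hasDerivWithinAt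
  have h2 : HasDerivWithinAt u 0 (Set.Icc a b) a :=
    (hasDerivWithinAt_const a (Set.Icc a b) (0 : E)).congr h0 (h0 a ha)
  exact (uniqueDiffOn_Icc hab a ha).eq_deriv _ h1 h2

lemma ode_growth (a b : ℝ) (hab : a < b) (z : ℂ) (u v : ℝ → ℂ) (hu : ∀ x, HasDerivAt u (v x) x)
    (hv : ∀ x : ℝ, HasDerivAt v ((x - z) * u x) x) (ua : u a = 0) (va : v a = 1)
    (k : ℝ) (hk : 1 ≤ k) (hkz : ∀ x ∈ Set.Icc a b, ‖(x : ℂ) - z‖ ≤ k ^ 2) :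
    ‖u b‖ ≤ Real.exp (k * (b - a)) := by
  have hk0 : 0 ≤ k := by linarith
  have hF : ∀ x : ℝ, HasDerivAt (fun x => ((k : ℂ) * u x, v x)) ((k : ℂ) * v x, (x - z) * u x) x :=
    fun x => ((hu x).const_mul (k : ℂ)).prodMk (hv x)
  have := norm_le_gronwallBound_of_norm_deriv_right_le (f := fun x => ((k : ℂ) * u x, v x))
    (f' := fun x : ℝ => ((k : ℂ) * v x, ((x : ℂ) - z) * u x)) (δ := 1) (K := k) (ε := 0) (a := a) (b := b)
    (fun x _ => (hF x).continuousAt.continuousWithinAt) (fun x _ => (hF x).hasDerivWithinAt)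
    (by simp [ua, va, Prod.norm_def])
    (by
      intro x hx
      rw [add_zero]
      simp only [Prod.norm_def, norm_mul, Complex.norm_real, Real.norm_eq_abs, abs_of_nonneg hk0]
      refine max_le ?_ ?_
      · gcongr
        exact le_max_right _ _
      · calc ‖(x : ℂ) - z‖ * ‖u x‖ ≤ k ^ 2 * ‖u x‖ := by
              gcongr; exact hkz x ⟨hx.1, hx.2.le⟩
          _ = k * (k * ‖u x‖) := by ring
          _ ≤ _ := by gcongr; exact le_max_left _ _) b (Set.right_mem_Icc.2 hab.le)
  rw [gronwallBound_ε0, one_mul] at this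
  refine le_trans ?_ this
  simp only [Prod.norm_def, norm_mul, Complex.norm_real, Real.norm_eq_abs, abs_of_nonneg hk0]
  refine le_trans ?_ (le_max_left _ _)
  nlinarith [norm_nonneg (u b)]

lemma hasDerivAt_re' {u : ℝ → ℂ} {v : ℂ} {x : ℝ} (h : HasDerivAt u v x) :
    HasDerivAt (fun x => (u x).re) v.re x :=
  Complex.reCLM.hasFDerivAt.comp_hasDerivAt x h

lemma hasDerivAt_im' {u : ℝ → ℂ} {v : ℂ} {x : ℝ} (h : HasDerivAt u v x) :
    HasDerivAt (fun x => (u x).im) v.im x :=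
  Complex.imCLM.hasFDerivAt.comp_hasDerivAt x h

lemma ode_real (a b : ℝ) (hab : a < b) (z : ℂ) (u v : ℝ → ℂ) (hu : ∀ x, HasDerivAt u (v x) x)
    (hv : ∀ x : ℝ, HasDerivAt v ((x - z) * u x) x) (ua : u a = 0) (va : v a = 1)
    (ub : u b = 0) : z.im = 0 := by
  by_contra hz
  have hd : ∀ x, HasDerivAt (fun x => -z.im * ((v x).im * (u x).re - (v x).re * (u x).im))
      (z.im ^ 2 * ((u x).re ^ 2 + (u x).im ^ 2)) x := by
    intro x
    refine (((((hasDerivAt_im' (hv x)).mul (hasDerivAt_re' (hu x)))).sub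
      ((hasDerivAt_re' (hv x)).mul (hasDerivAt_im' (hu x)))).const_mul (-z.im)).congr_deriv ?_
    simp
    ring
  have h0 := eq_zero_of_mono a b hab _ _ hd (fun x _ => by positivity) (by simp [ua, ub])
  have hu0 : ∀ x ∈ Set.Icc a b, u x = 0 := by
    intro x hx
    have h1 := h0 x hx
    have h2 : (u x).re ^ 2 + (u x).im ^ 2 = 0 := by
      rcases mul_eq_zero.1 h1 with h | h
      · exact absurd (pow_eq_zero_iff (by norm_num) |>.1 h) hz
      · exact h
    apply Complex.ext
    · simp; nlinarith [sq_nonneg (u x).re, sq_nonneg (u x).im]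
    · simp; nlinarith [sq_nonneg (u x).re, sq_nonneg (u x).im]
  have := deriv_zero_of_zero a b hab u v hu hu0
  rw [va] at this
  exact one_ne_zero this

lemma ode_low (a b : ℝ) (hab : a < b) (z : ℂ) (u v : ℝ → ℂ) (hu : ∀ x, HasDerivAt u (v x) x)
    (hv : ∀ x : ℝ, HasDerivAt v ((x - z) * u x) x) (ua : u a = 0) (va : v a = 1)
    (ub : u b = 0) : a ≤ z.re := by
  by_contra hz
  push Not at hz
  have hd : ∀ x, HasDerivAt (fun x => (v x).re * (u x).re + (v x).im * (u x).im)
      ((v x).re ^ 2 + (v x).im ^ 2 + (x - z.re) * ((u x).re ^ 2 + (u x).im ^ 2)) x := by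
    intro x
    refine ((((hasDerivAt_re' (hv x)).mul (hasDerivAt_re' (hu x)))).add
      ((hasDerivAt_im' (hv x)).mul (hasDerivAt_im' (hu x)))).congr_deriv ?_
    simp
    ring
  have h0 := eq_zero_of_mono a b hab _ _ hd (fun x hx => by
    have : 0 ≤ x - z.re := by linarith [hx.1]
    positivity) (by simp [ua, ub]) a (Set.left_mem_Icc.2 hab.le)
  simp [ua, va] at h0

lemma ode_simple (a b : ℝ) (hab : a < b) (z : ℝ) (u v : ℝ → ℝ) (hu : ∀ x, HasDerivAt u (v x) x)
    (hv : ∀ x : ℝ, HasDerivAt v ((x - z) * u x) x) (ua : u a = 0) (va : v a = 1)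
    (ub : u b = 0) : v b ^ 2 ≠ 1 := by
  intro hvb
  have hd : ∀ x, HasDerivAt (fun x => (x - z) * u x ^ 2 - v x ^ 2) (u x ^ 2) x := by
    intro x
    refine ((((hasDerivAt_id x).sub_const z).mul ((hu x).pow 2)).sub ((hv x).pow 2)).congr_deriv ?_
    simp
    ring
  have h0 := eq_zero_of_mono a b hab _ _ hd (fun x _ => by positivity) (by simp [ua, ub, va, hvb])
  have := deriv_zero_of_zero a b hab u v hu fun x hx => by simpa using h0 x hx
  rw [va] at this
  exact one_ne_zero this

/-- For the Schrödinger operator `−d²/dx² + x` on `(a,b)` with Dirichlet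
boundary conditions, whose eigenvalues are the solutions `z` of
`Ai(a−z)Bi(b−z) = Bi(a−z)Ai(b−z)` (`Ai`, `Bi` the Airy functions, characterized here by
`y'' = x y` and Wronskian `Ai Bi' − Ai' Bi = 1/π`), if zero is not an eigenvalue
(`Ai(a)Bi(b) ≠ Bi(a)Ai(b)`) then the sum of reciprocals of the eigenvalues equals
`π (Bi(a)Ai(b) − Ai(a)Bi(b))⁻¹ [Ai(a)Ai(b)(Bi'(a)² − Bi'(b)²)
 + Bi(a)Bi(b)(Ai'(a)² − Ai'(b)²)
 + (Ai'(b)Bi'(b) − Ai'(a)Bi'(a))(Bi(a)Ai(b) + Ai(a)Bi(b))]`. -/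
theorem linear_potential_trace (a b : ℝ) (hab : a < b)
    (Ai Bi : ℝ → ℝ) (hAi : ContDiff ℝ 2 Ai) (hBi : ContDiff ℝ 2 Bi)
    (hAiODE : ∀ x : ℝ, deriv (deriv Ai) x = x * Ai x)
    (hBiODE : ∀ x : ℝ, deriv (deriv Bi) x = x * Bi x)
    (hW : ∀ x : ℝ, Ai x * deriv Bi x - deriv Ai x * Bi x = 1 / Real.pi)
    (h0 : Ai a * Bi b ≠ Bi a * Ai b) :
    ∑' lam : {z : ℝ // Ai (a - z) * Bi (b - z) = Bi (a - z) * Ai (b - z)},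
        ((lam : ℝ))⁻¹ =
      Real.pi * (Bi a * Ai b - Ai a * Bi b)⁻¹ *
        (Ai a * Ai b * ((deriv Bi a)^2 - (deriv Bi b)^2)
          + Bi a * Bi b * ((deriv Ai a)^2 - (deriv Ai b)^2)
          + (deriv Ai b * deriv Bi b - deriv Ai a * deriv Bi a)
              * (Bi a * Ai b + Ai a * Bi b)) := by
  obtain ⟨A, A', hA, hA', Ar, Ar'⟩ := airy_extend Ai hAi hAiODE
  obtain ⟨B, B', hB, hB', Br, Br'⟩ := airy_extend Bi hBi hBiODE
  have hpi : (Real.pi : ℂ) ≠ 0 := by exact_mod_cast Real.pi_ne_zero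
  have hWc : ∀ z, A z * B' z - A' z * B z = 1 / (Real.pi : ℂ) := by
    have hd : ∀ z, HasDerivAt (fun z => A z * B' z - A' z * B z) 0 z := fun z => by
      refine HasDerivAt.congr_deriv (((hA z).mul (hB' z)).sub ((hA' z).mul (hB z))) ?_
      ring
    intro z
    have h1 := is_const_of_deriv_eq_zero (fun z => (hd z).differentiableAt) (fun z => (hd z).deriv) z ((0 : ℝ) : ℂ)
    rw [h1, Ar, Ar', Br, Br']
    exact_mod_cast hW 0
  set f : ℂ → ℂ := fun z => Real.pi * (A (a - z) * B (b - z) - B (a - z) * A (b - z)) with hf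
  have hsub : ∀ (c z : ℂ), HasDerivAt (fun z => c - z) (-1) z := fun c z =>
    (hasDerivAt_id z).const_sub c
  have hfd : ∀ z, HasDerivAt f (Real.pi * (-A' (a - z) * B (b - z) - A (a - z) * B' (b - z)
      + B' (a - z) * A (b - z) + B (a - z) * A' (b - z))) z := by
    intro z
    refine HasDerivAt.congr_deriv ((((((hA _).comp z (hsub a z)).mul ((hB _).comp z (hsub b z))).sub
      (((hB _).comp z (hsub a z)).mul ((hA _).comp z (hsub b z)))).const_mul (Real.pi : ℂ))) ?_
    simp only [Function.comp]
    ring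
  set u : ℂ → ℝ → ℂ := fun z x => Real.pi * (A (a - z) * B (x - z) - B (a - z) * A (x - z)) with hu
  set v : ℂ → ℝ → ℂ := fun z x => Real.pi * (A (a - z) * B' (x - z) - B (a - z) * A' (x - z)) with hv
  have hadd : ∀ (z : ℂ) (x : ℝ), HasDerivAt (fun x : ℝ => (x : ℂ) - z) 1 x := fun z x =>
    (Complex.ofRealCLM.hasDerivAt (x := x)).sub_const z
  have hud : ∀ z x, HasDerivAt (u z) (v z x) x := by
    intro z x
    refine HasDerivAt.congr_deriv (((((hB _).comp x (hadd z x)).const_mul (A (a - z))).sub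
      (((hA _).comp x (hadd z x)).const_mul (B (a - z)))).const_mul (Real.pi : ℂ)) ?_
    simp only [hv]
    ring
  have hvd : ∀ (z : ℂ) (x : ℝ), HasDerivAt (v z) ((x - z) * u z x) x := by
    intro z x
    refine HasDerivAt.congr_deriv (((((hB' _).comp x (hadd z x)).const_mul (A (a - z))).sub
      (((hA' _).comp x (hadd z x)).const_mul (B (a - z)))).const_mul (Real.pi : ℂ)) ?_
    simp only [hu]
    ring
  have hua : ∀ z, u z a = 0 := fun z => by simp only [hu]; ring
  have hva : ∀ z, v z a = 1 := fun z => by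
    have h1 := hWc (a - z)
    have h2 : (Real.pi : ℂ) * (1 / Real.pi) = 1 := by field_simp
    simp only [hv]
    linear_combination (Real.pi : ℂ) * h1 + h2
  have hub : ∀ z, u z b = f z := fun z => rfl
  have hP : ∀ x : ℝ, Ai (a - x) * Bi (b - x) = Bi (a - x) * Ai (b - x) ↔ f (x : ℂ) = 0 := by
    intro x
    have : f (x : ℂ) = ((Real.pi * (Ai (a - x) * Bi (b - x) - Bi (a - x) * Ai (b - x)) : ℝ) : ℂ) := by
      simp only [hf, ← Complex.ofReal_sub, Ar, Br]
      push_cast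
      rfl
    rw [this, Complex.ofReal_eq_zero, mul_eq_zero, or_iff_right Real.pi_ne_zero, sub_eq_zero]
  have hf0 : f 0 ≠ 0 := by
    have := (hP 0).not.1 (by simpa using h0)
    simpa using this
  set E : ℝ := 1 + max |a| |b| with hE
  have hE1 : 1 ≤ E := by
    have : 0 ≤ max |a| |b| := le_max_of_le_left (abs_nonneg a)
    linarith
  refine (recip_sum f (fun z => (hfd z).differentiableAt) (√E * (b - a)) ?_ ?_ _ hP ?_ ?_ a ?_ hf0 _ ?_).tsum_eq
  · have : 0 < b - a := by linarith
    positivity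
  · intro z hz
    have hEz : 1 ≤ E * ‖z‖ := by nlinarith
    have := ode_growth a b hab z (u z) (v z) (hud z) (hvd z) (hua z) (hva z) (√(E * ‖z‖))
      (Real.one_le_sqrt.2 hEz) (by
        intro x hx
        rw [Real.sq_sqrt (by linarith)]
        have h1 : |x| ≤ max |a| |b| := abs_le_max_abs_abs hx.1 hx.2
        calc ‖(x : ℂ) - z‖ ≤ ‖(x : ℂ)‖ + ‖z‖ := norm_sub_le _ _
          _ = |x| + ‖z‖ := by rw [Complex.norm_real, Real.norm_eq_abs]
          _ ≤ E * ‖z‖ := by nlinarith [abs_nonneg x])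
    rw [hub] at this
    refine this.trans (le_of_eq ?_)
    rw [Real.sqrt_mul (by linarith)]
    congr 1
    ring
  · intro z hz
    have := ode_real a b hab z (u z) (v z) (hud z) (hvd z) (hua z) (hva z) (by rw [hub]; exact hz)
    exact ⟨z.re, by apply Complex.ext <;> simp [this]⟩
  · intro x hx hder
    have hx' := (hP x).2 hx
    rw [(hfd x).deriv] at hder
    simp only [← Complex.ofReal_sub, Ar, Br, Ar', Br'] at hder
    have hder' : Real.pi * (-deriv Ai (a - x) * Bi (b - x) - Ai (a - x) * deriv Bi (b - x)
      + deriv Bi (a - x) * Ai (b - x) + Bi (a - x) * deriv Ai (b - x)) = 0 := by exact_mod_cast hder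
    have hder2 := (mul_eq_zero.1 hder').resolve_left Real.pi_ne_zero
    have dA : ∀ y, HasDerivAt Ai (deriv Ai y) y := fun y =>
      ((hAi.differentiable (by norm_num)) y).hasDerivAt
    have dB : ∀ y, HasDerivAt Bi (deriv Bi y) y := fun y =>
      ((hBi.differentiable (by norm_num)) y).hasDerivAt
    have dA' : ∀ y, HasDerivAt (deriv Ai) (y * Ai y) y := fun y => by
      rw [← hAiODE]; exact ((hAi.differentiable_deriv_two) y).hasDerivAt
    have dB' : ∀ y, HasDerivAt (deriv Bi) (y * Bi y) y := fun y => by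
      rw [← hBiODE]; exact ((hBi.differentiable_deriv_two) y).hasDerivAt
    have hs : ∀ y : ℝ, HasDerivAt (fun y : ℝ => y - x) 1 y := fun y => (hasDerivAt_id y).sub_const x
    have hWa := hW (a - x)
    have hWb := hW (b - x)
    have hpp : Real.pi * (1 / Real.pi) = 1 := by field_simp
    refine ode_simple a b hab x
      (fun y => Real.pi * (Ai (a - x) * Bi (y - x) - Bi (a - x) * Ai (y - x)))
      (fun y => Real.pi * (Ai (a - x) * deriv Bi (y - x) - Bi (a - x) * deriv Ai (y - x)))
      (fun y => ?_) (fun y => ?_) ?_ ?_ ?_ ?_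
    · refine HasDerivAt.congr_deriv (((((dB _).comp y (hs y)).const_mul (Ai (a - x))).sub
        (((dA _).comp y (hs y)).const_mul (Bi (a - x)))).const_mul Real.pi) ?_
      ring
    · refine HasDerivAt.congr_deriv (((((dB' _).comp y (hs y)).const_mul (Ai (a - x))).sub
        (((dA' _).comp y (hs y)).const_mul (Bi (a - x)))).const_mul Real.pi) ?_
      ring
    · ring
    · linear_combination Real.pi * hWa + hpp
    · show _ = _
      linear_combination Real.pi * hx'
    · show _ = _
      generalize Ai (a - x) = p at *
      generalize Bi (a - x) = q at *
      generalize deriv Ai (a - x) = p' at *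
      generalize deriv Bi (a - x) = q' at *
      generalize Ai (b - x) = r at *
      generalize Bi (b - x) = t at *
      generalize deriv Ai (b - x) = r' at *
      generalize deriv Bi (b - x) = t' at *
      have e1 : p * t' - q * r' = q' * r - p' * t := by linear_combination -hder2
      have e2 : (q' * r - p' * t) * (p * t' - q * r') = (p * q' - p' * q) * (r * t' - r' * t) := by
        linear_combination (q' * r' - p' * t') * hx'
      calc (Real.pi * (p * t' - q * r')) ^ 2
          = Real.pi ^ 2 * ((p * t' - q * r') * (p * t' - q * r')) := by ring
        _ = Real.pi ^ 2 * ((q' * r - p' * t) * (p * t' - q * r')) := by nth_rewrite 1 [e1]; rfl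
        _ = Real.pi ^ 2 * (1 / Real.pi * (1 / Real.pi)) := by rw [e2, hWa, hWb]
        _ = 1 := by field_simp
  · intro x hx
    simpa using ode_low a b hab x (u x) (v x) (hud x) (hvd x) (hua x) (hva x) (by rw [hub]; exact hx)
  · rw [(hfd 0).deriv, hf]
    simp only [sub_zero, Ar, Br, Ar', Br']
    norm_cast
    have hWa := hW a
    have hWb := hW b
    have n1 : Ai a * Bi b - Bi a * Ai b ≠ 0 := sub_ne_zero.2 h0
    have n2 : Bi a * Ai b - Ai a * Bi b ≠ 0 := sub_ne_zero.2 (fun h => h0 (by linarith))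
    have hbr : Real.pi * (Ai a * Ai b * ((deriv Bi a)^2 - (deriv Bi b)^2)
          + Bi a * Bi b * ((deriv Ai a)^2 - (deriv Ai b)^2)
          + (deriv Ai b * deriv Bi b - deriv Ai a * deriv Bi a)
              * (Bi a * Ai b + Ai a * Bi b)) =
        -deriv Ai a * Bi b - Ai a * deriv Bi b + deriv Bi a * Ai b + Bi a * deriv Ai b := by
      have hpp : Real.pi * (1 / Real.pi) = 1 := by field_simp
      have e1 : Real.pi * (Ai a * deriv Bi a - deriv Ai a * Bi a) = 1 := by rw [hWa, hpp]
      have e2 : Real.pi * (Ai b * deriv Bi b - deriv Ai b * Bi b) = 1 := by rw [hWb, hpp]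
      linear_combination (Ai b * deriv Bi a - deriv Ai a * Bi b) * e1 - (Ai a * deriv Bi b - Bi a * deriv Ai b) * e2
    rw [mul_div_mul_left _ _ Real.pi_ne_zero, mul_right_comm, hbr, ← div_eq_mul_inv, ← div_neg]
    congr 1
    ring
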